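/- Let K be a continuous Hermitian kernel on S² × S² of the block form K(ξ,ζ) = Σ_{j=0}^∞ Σ_{k=−j}^{j} Σ_{k'=−j}^{j} d_j(k,k') Y_j^k(ξ) conj(Y_j^{k'}(ζ)). If the operator D_j is strictly positive (Hermitian positive definite) for every j ∈ ℕ, then K is strictly positive definite. -/

import Mathlib

open scoped ComplexOrder
open Polynomial

noncomputable section

/-- The unit 2-sphere `S² ⊆ ℝ³`. -/
abbrev S2 := Metric.sphere (0 : EuclideanSpace ℝ (Fin 3)) 1

/-- The Legendre polynomial of degree `j` (Rodrigues' formula), normalized so that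
`P j 1 = 1`. -/
noncomputable def legP (j : ℕ) : Polynomial ℝ :=
  Polynomial.C (1 / ((2 : ℝ) ^ j * (j.factorial : ℝ))) *
    (Polynomial.derivative^[j] ((Polynomial.X ^ 2 - 1) ^ j))

/-- The associated Legendre function `P_{j,m}` for nonnegative order `m`. -/
noncomputable def assocLegNat (j m : ℕ) (x : ℝ) : ℝ :=
  (-1 : ℝ) ^ m * Real.sqrt (1 - x ^ 2) ^ m *
    (Polynomial.derivative^[m] (legP j)).eval x

/-- The associated Legendre function `P_{j,k}` for integer order `k`,
with `P_{j,-m} = (-1)^m (j-m)!/(j+m)! P_{j,m}`. -/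
noncomputable def assocLeg (j : ℕ) (k : ℤ) (x : ℝ) : ℝ :=
  if 0 ≤ k then assocLegNat j k.toNat x
  else (-1 : ℝ) ^ (-k).toNat *
    (((j - (-k).toNat).factorial : ℝ) / ((j + (-k).toNat).factorial : ℝ)) *
    assocLegNat j (-k).toNat x

/-- The complex spherical harmonic `Y_j^k`, expressed through the Cartesian
coordinates of a point `ξ` of the sphere: the polar angle `θ` satisfies
`cos θ = ξ₃`, and the azimuth `φ` is the argument of `ξ₁ + i ξ₂`, so that
`Y_j^k(ξ) = (1/√(2π)) √((2j+1)/2 · (j−k)!/(j+k)!) · P_{j,k}(cos θ) · e^{ikφ}`. -/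
noncomputable def sphY (j : ℕ) (k : ℤ) (ξ : S2) : ℂ :=
  ((1 / Real.sqrt (2 * Real.pi) *
      Real.sqrt ((2 * (j : ℝ) + 1) / 2 *
        ((((j : ℤ) - k).toNat.factorial : ℝ) / (((j : ℤ) + k).toNat.factorial : ℝ))) *
      assocLeg j k ((ξ : EuclideanSpace ℝ (Fin 3)) 2) : ℝ) : ℂ) *
    Complex.exp (Complex.I * (k : ℂ) *
      ((Complex.arg ((((ξ : EuclideanSpace ℝ (Fin 3)) 0 : ℝ) : ℂ) +
        (((ξ : EuclideanSpace ℝ (Fin 3)) 1 : ℝ) : ℂ) * Complex.I) : ℝ) : ℂ))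

/-- Single-index enumeration `(F_ℓ)` of the spherical harmonics: `sphF n = Y_j^k`
with `n = j² + j + k`, `j = ⌊√n⌋`, i.e. the paper's numbering `F_{j²+j+1+k} = Y_j^k`
(indices shifted by one so that `sphF n = F_{n+1}`). -/
noncomputable def sphF (n : ℕ) : S2 → ℂ :=
  sphY n.sqrt ((n : ℤ) - n.sqrt ^ 2 - n.sqrt)

/-- A kernel on the sphere is positive definite if each of its quadratic forms on a
nonempty finite set of (distinct) points is nonnegative. -/
def IsPosDefKer (K : S2 → S2 → ℂ) : Prop :=
  ∀ Ξ : Finset S2, Ξ.Nonempty → ∀ c : S2 → ℂ,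
    0 ≤ ∑ ξ ∈ Ξ, ∑ ζ ∈ Ξ, c ξ * (starRingEnd ℂ) (c ζ) * K ξ ζ

/-- A kernel on the sphere is strictly positive definite if each of its quadratic
forms on a nonempty finite set of (distinct) points, with coefficients not all zero,
is positive. -/
def IsStrictPosDefKer (K : S2 → S2 → ℂ) : Prop :=
  ∀ Ξ : Finset S2, Ξ.Nonempty → ∀ c : S2 → ℂ, (∃ ξ ∈ Ξ, c ξ ≠ 0) →
    0 < ∑ ξ ∈ Ξ, ∑ ζ ∈ Ξ, c ξ * (starRingEnd ℂ) (c ζ) * K ξ ζ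

/-- The matrix `D_j = (d_j(k,k'))_{k,k'=-j}^j` of a block kernel. -/
def Dmat (d : ℕ → ℤ → ℤ → ℂ) (j : ℕ) : Matrix (Fin (2 * j + 1)) (Fin (2 * j + 1)) ℂ :=
  fun k k' => d j ((k : ℤ) - j) ((k' : ℤ) - j)

/-- `K` has the pointwise convergent block spherical harmonic expansion
`K(ξ,ζ) = Σ_{j=0}^∞ Σ_{k=-j}^j Σ_{k'=-j}^j d_j(k,k') Y_j^k(ξ) conj(Y_j^{k'}(ζ))`. -/
def HasBlockExpansion (K : S2 → S2 → ℂ) (d : ℕ → ℤ → ℤ → ℂ) : Prop :=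
  ∀ ξ ζ : S2, HasSum (fun j : ℕ =>
    ∑ k ∈ Finset.Icc (-(j : ℤ)) j, ∑ k' ∈ Finset.Icc (-(j : ℤ)) j,
      d j k k' * sphY j k ξ * (starRingEnd ℂ) (sphY j k' ζ)) (K ξ ζ)

lemma natDegree_iterate_derivative_eq (p : ℝ[X]) (n : ℕ) :
    (derivative^[n] p).natDegree = p.natDegree - n := by
  induction n with
  | zero => simp
  | succ n ih => rw [Function.iterate_succ_apply', natDegree_derivative, ih, Nat.sub_sub]

lemma degree_iterate_derivative_eq {p : ℝ[X]} (hp : p ≠ 0) {n : ℕ} (hn : n ≤ p.natDegree) :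
    (derivative^[n] p).degree = (p.natDegree - n : ℕ) := by
  have hne : derivative^[n] p ≠ 0 := by
    intro h
    have hc : (derivative^[n] p).coeff (p.natDegree - n) = 0 := by simp [h]
    rw [coeff_iterate_derivative, Nat.sub_add_cancel hn, nsmul_eq_mul, mul_eq_zero,
      Nat.cast_eq_zero, Nat.descFactorial_eq_zero_iff_lt, coeff_natDegree,
      leadingCoeff_eq_zero] at hc
    exact hc.elim hn.not_gt hp
  rw [degree_eq_natDegree hne, natDegree_iterate_derivative_eq]

lemma natDegree_X_sq_sub_one_pow (j : ℕ) : ((X ^ 2 - 1 : ℝ[X]) ^ j).natDegree = 2 * j := by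
  have h : (X ^ 2 - 1 : ℝ[X]).natDegree = 2 := by
    rw [← C_1]
    exact natDegree_X_pow_sub_C
  rw [natDegree_pow, h, mul_comm]

lemma degree_legP (j : ℕ) : (legP j).degree = j := by
  have hne : ((X ^ 2 - 1 : ℝ[X]) ^ j) ≠ 0 := by
    apply pow_ne_zero
    rw [← C_1]
    exact X_pow_sub_C_ne_zero two_pos 1
  have hdeg := natDegree_X_sq_sub_one_pow j
  rw [legP, degree_C_mul (by positivity), degree_iterate_derivative_eq hne (by omega), hdeg]
  congr 1
  omega

/-- The `m`-th derivatives of the Legendre polynomials of degree at least `m`. -/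
def derivLegSequence (m : ℕ) : Polynomial.Sequence ℝ where
  elems' i := derivative^[m] (legP (i + m))
  degree_eq' i := by
    have hd : (legP (i + m)).natDegree = i + m := natDegree_eq_of_degree_eq_some (degree_legP _)
    have hne : legP (i + m) ≠ 0 := by
      intro h
      have := degree_legP (i + m)
      simp only [h, degree_zero] at this
      exact WithBot.bot_ne_coe this
    rw [degree_iterate_derivative_eq hne (by omega), hd, Nat.add_sub_cancel]

lemma span_derivLegSequence (m : ℕ) :
    Submodule.span ℝ (Set.range (derivLegSequence m)) = ⊤ :=
  (derivLegSequence m).span fun i => (leadingCoeff_ne_zero.mpr ((derivLegSequence m).ne_zero i)).isUnit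

/-- The horizontal coordinate `ξ₁ + i ξ₂` of a point of the sphere. -/
def horiz (ξ : S2) : ℂ :=
  (((ξ : EuclideanSpace ℝ (Fin 3)) 0 : ℝ) : ℂ) +
    (((ξ : EuclideanSpace ℝ (Fin 3)) 1 : ℝ) : ℂ) * Complex.I

/-- The height `ξ₃` of a point of the sphere. -/
def height (ξ : S2) : ℝ := (ξ : EuclideanSpace ℝ (Fin 3)) 2

lemma norm_horiz (ξ : S2) : ‖horiz ξ‖ = Real.sqrt (1 - height ξ ^ 2) := by
  have h : ‖(ξ : EuclideanSpace ℝ (Fin 3))‖ = 1 := by simp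
  rw [EuclideanSpace.norm_eq, Real.sqrt_eq_one, Fin.sum_univ_three] at h
  simp only [Real.norm_eq_abs, sq_abs] at h
  rw [horiz, Complex.norm_add_mul_I, height]
  congr 1
  linarith

lemma eq_of_horiz_eq_of_height_eq {ξ ζ : S2} (hw : horiz ξ = horiz ζ)
    (hz : height ξ = height ζ) : ξ = ζ := by
  have h0 := congrArg Complex.re hw
  have h1 := congrArg Complex.im hw
  simp [horiz] at h0 h1
  ext i
  fin_cases i
  exacts [h0, h1, hz]

/-- Spherical harmonics of nonnegative order in Cartesian coordinates, up to a nonzero factor. -/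
lemma exists_sphY_eq (j m : ℕ) : ∃ a : ℝ, a ≠ 0 ∧ ∀ ξ : S2,
    sphY j m ξ = a * (horiz ξ ^ m * ((derivative^[m] (legP j)).eval (height ξ) : ℝ)) := by
  refine ⟨1 / Real.sqrt (2 * Real.pi) * Real.sqrt ((2 * (j : ℝ) + 1) / 2 *
    ((((j : ℤ) - m).toNat.factorial : ℝ) / (((j : ℤ) + m).toNat.factorial : ℝ))) * (-1) ^ m,
    by positivity, fun ξ => ?_⟩
  have hexp : horiz ξ ^ m = ((Real.sqrt (1 - height ξ ^ 2) : ℝ) : ℂ) ^ m *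
      Complex.exp (Complex.I * (m : ℂ) * (Complex.arg (horiz ξ) : ℝ)) := by
    rw [← norm_horiz]
    conv_lhs => rw [← Complex.norm_mul_exp_arg_mul_I (horiz ξ), mul_pow, ← Complex.exp_nat_mul]
    congr 2
    ring
  rw [hexp, sphY, assocLeg, if_pos (Int.natCast_nonneg m), Int.toNat_natCast, assocLegNat]
  simp only [horiz, height]
  push_cast
  ring

/-- A functional supported on finitely many points that annihilates all spherical harmonics
annihilates the products of powers of `ξ₁ + i ξ₂` with polynomials in `ξ₃`. -/
lemma sum_horiz_pow_mul_eval_eq_zero {Ξ : Finset S2} {c : S2 → ℂ}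
    (h : ∀ j m : ℕ, m ≤ j → ∑ ξ ∈ Ξ, c ξ * sphY j m ξ = 0) (m : ℕ) (q : ℝ[X]) :
    ∑ ξ ∈ Ξ, c ξ * (horiz ξ ^ m * (q.eval (height ξ) : ℝ)) = 0 := by
  have hq : q ∈ Submodule.span ℝ (Set.range (derivLegSequence m)) := by
    simp [span_derivLegSequence]
  induction hq using Submodule.span_induction with
  | mem p hp =>
    obtain ⟨i, rfl⟩ := hp
    obtain ⟨a, ha, hY⟩ := exists_sphY_eq (i + m) m
    have hs := h (i + m) m (by omega)
    simp only [hY, mul_left_comm (c _) (a : ℂ), ← Finset.mul_sum, mul_eq_zero,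
      Complex.ofReal_eq_zero, ha, false_or] at hs
    exact hs
  | zero => simp
  | add p₁ p₂ _ _ h₁ h₂ =>
    simp only [eval_add, Complex.ofReal_add, mul_add, Finset.sum_add_distrib, h₁, h₂, add_zero]
  | smul a p _ hp =>
    simp only [eval_smul, smul_eq_mul, Complex.ofReal_mul, mul_left_comm _ (a : ℂ),
      ← Finset.mul_sum, hp, mul_zero]

lemma sum_eval_horiz_mul_eval_eq_zero {Ξ : Finset S2} {c : S2 → ℂ}
    (h : ∀ j m : ℕ, m ≤ j → ∑ ξ ∈ Ξ, c ξ * sphY j m ξ = 0) (p : ℂ[X]) (q : ℝ[X]) :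
    ∑ ξ ∈ Ξ, c ξ * (p.eval (horiz ξ) * (q.eval (height ξ) : ℝ)) = 0 := by
  induction p using Polynomial.induction_on' with
  | add p₁ p₂ h₁ h₂ => simp only [eval_add, add_mul, mul_add, Finset.sum_add_distrib, h₁, h₂,
      add_zero]
  | monomial m a =>
    simp only [eval_monomial, mul_assoc a, mul_left_comm _ a, ← Finset.mul_sum,
      sum_horiz_pow_mul_eval_eq_zero h, mul_zero]

/-- Spherical harmonics separate finitely supported functionals on the sphere. -/
lemma coeff_eq_zero_of_sum_sphY_eq_zero {Ξ : Finset S2} {c : S2 → ℂ}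
    (h : ∀ j m : ℕ, m ≤ j → ∑ ξ ∈ Ξ, c ξ * sphY j m ξ = 0) {η : S2} (hη : η ∈ Ξ) : c η = 0 := by
  classical
  let p : ℂ[X] := ∏ ζ ∈ Ξ with horiz ζ ≠ horiz η, (X - C (horiz ζ))
  let q : ℝ[X] := ∏ ζ ∈ Ξ with height ζ ≠ height η, (X - C (height ζ))
  have hp : p.eval (horiz η) ≠ 0 := by
    simp only [p, eval_prod, eval_sub, eval_X, eval_C, Finset.prod_ne_zero_iff, sub_ne_zero]
    exact fun ζ hζ => (Finset.mem_filter.mp hζ).2.symm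
  have hq : q.eval (height η) ≠ 0 := by
    simp only [q, eval_prod, eval_sub, eval_X, eval_C, Finset.prod_ne_zero_iff, sub_ne_zero]
    exact fun ζ hζ => (Finset.mem_filter.mp hζ).2.symm
  have hsum := sum_eval_horiz_mul_eval_eq_zero h p q
  rw [Finset.sum_eq_single_of_mem η hη] at hsum
  · simpa [hp, hq] using hsum
  · intro ξ hξ hne
    by_cases hw : horiz ξ = horiz η
    · have hz : height ξ ≠ height η := fun hz => hne (eq_of_horiz_eq_of_height_eq hw hz)
      have : q.eval (height ξ) = 0 := by
        rw [eval_prod]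
        exact Finset.prod_eq_zero (Finset.mem_filter.mpr ⟨hξ, hz⟩) (by simp)
      simp [this]
    · have : p.eval (horiz ξ) = 0 := by
        rw [eval_prod]
        exact Finset.prod_eq_zero (Finset.mem_filter.mpr ⟨hξ, hw⟩) (by simp)
      simp [this]

lemma sum_Icc_neg_eq_sum_fin (j : ℕ) (f : ℤ → ℂ) :
    ∑ k ∈ Finset.Icc (-(j : ℤ)) j, f k = ∑ i : Fin (2 * j + 1), f ((i : ℤ) - j) := by
  symm
  refine Finset.sum_bij (fun i _ => (i : ℤ) - j) (fun i _ => ?_) (fun a _ b _ hab => ?_)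
    (fun k hk => ?_) (fun _ _ => rfl)
  · rw [Finset.mem_Icc]
    omega
  · ext
    omega
  · rw [Finset.mem_Icc] at hk
    exact ⟨⟨(k + j).toNat, by omega⟩, Finset.mem_univ _, by simp only; omega⟩

/-- The degree-`j` block of the quadratic form of a kernel is a Hermitian form of `D_j`. -/
lemma sum_block_eq_dotProduct (d : ℕ → ℤ → ℤ → ℂ) (Ξ : Finset S2) (c : S2 → ℂ) (j : ℕ)
    (x : Fin (2 * j + 1) → ℂ)
    (hx : x = star fun i : Fin (2 * j + 1) => ∑ ξ ∈ Ξ, c ξ * sphY j ((i : ℤ) - j) ξ) :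
    ∑ ξ ∈ Ξ, ∑ ζ ∈ Ξ, c ξ * (starRingEnd ℂ) (c ζ) *
      (∑ k ∈ Finset.Icc (-(j : ℤ)) j, ∑ k' ∈ Finset.Icc (-(j : ℤ)) j,
        d j k k' * sphY j k ξ * (starRingEnd ℂ) (sphY j k' ζ)) =
    star x ⬝ᵥ (Dmat d j).mulVec x := by
  simp only [sum_Icc_neg_eq_sum_fin, Finset.mul_sum]
  rw [hx, star_star]
  calc
    _ = ∑ ξ ∈ Ξ, ∑ i : Fin (2 * j + 1), ∑ ζ ∈ Ξ, ∑ i' : Fin (2 * j + 1),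
        c ξ * (starRingEnd ℂ) (c ζ) * (d j ((i : ℤ) - j) ((i' : ℤ) - j) *
          sphY j ((i : ℤ) - j) ξ * (starRingEnd ℂ) (sphY j ((i' : ℤ) - j) ζ)) :=
      Finset.sum_congr rfl fun _ _ => Finset.sum_comm
    _ = _ := by
      rw [Finset.sum_comm, dotProduct]
      refine Finset.sum_congr rfl fun i _ => ?_
      rw [Matrix.mulVec, dotProduct, Finset.sum_mul]
      refine Finset.sum_congr rfl fun ξ _ => ?_
      rw [Finset.sum_comm, Finset.mul_sum]
      refine Finset.sum_congr rfl fun i' _ => ?_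
      simp only [Dmat, Pi.star_apply, star_sum, star_mul', RCLike.star_def, Finset.mul_sum]
      exact Finset.sum_congr rfl fun ζ _ => by ring

/-- **Proposition 1.** A continuous Hermitian kernel `K` with block expansion
coefficients `d_j(k,k')` is strictly positive definite if every operator `D_j` is
strictly positive (Hermitian positive definite). -/
theorem statement7 (K : S2 → S2 → ℂ) (d : ℕ → ℤ → ℤ → ℂ)
    (hcont : Continuous fun p : S2 × S2 => K p.1 p.2)
    (hherm : ∀ ξ ζ : S2, K ξ ζ = (starRingEnd ℂ) (K ζ ξ))
    (hexp : HasBlockExpansion K d)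
    (hpos : ∀ j : ℕ, (Dmat d j).PosDef) :
    IsStrictPosDefKer K := by
  intro Ξ _ c hc
  let x (j : ℕ) : Fin (2 * j + 1) → ℂ :=
    star fun i => ∑ ξ ∈ Ξ, c ξ * sphY j ((i : ℤ) - j) ξ
  have hsum : HasSum (fun j => star (x j) ⬝ᵥ (Dmat d j).mulVec (x j))
      (∑ ξ ∈ Ξ, ∑ ζ ∈ Ξ, c ξ * (starRingEnd ℂ) (c ζ) * K ξ ζ) := by
    simp only [← sum_block_eq_dotProduct d Ξ c _ _ rfl, x]
    exact hasSum_sum fun ξ _ => hasSum_sum fun ζ _ => (hexp ξ ζ).mul_left _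
  have hnonneg (j : ℕ) : 0 ≤ star (x j) ⬝ᵥ (Dmat d j).mulVec (x j) :=
    (hpos j).posSemidef.dotProduct_mulVec_nonneg _
  obtain ⟨j, hj⟩ : ∃ j, x j ≠ 0 := by
    by_contra! hzero
    obtain ⟨η, hη, hcη⟩ := hc
    refine hcη (coeff_eq_zero_of_sum_sphY_eq_zero (fun j m hm => ?_) hη)
    have := congrFun (star_eq_zero.mp (hzero j)) ⟨m + j, by omega⟩
    simpa using this
  exact ((hpos j).dotProduct_mulVec_pos hj).trans_le (le_hasSum hsum j fun i _ => hnonneg i)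

end
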